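/- arXiv:2210.00654 — 5 statements merged into one kernel-verified Lean document; each statement's English description precedes it below -/
import Mathlib

section
/- Let W be a set and 𝔄 a family of binary relations on W closed under composition ∘, the residuals \ and /, and intersection ∩, and let 1_𝔄 ∈ 𝔄 be the 𝔄-unit, i.e. 1_𝔄 ∘ R = R ∘ 1_𝔄 = R for every R ∈ 𝔄. Then for every R ∈ 𝔄, 1_𝔄 ⊆ R if and only if δ ⊆ R; in particular δ ⊆ 1_𝔄. -/
/-- Relational composition of binary relations on `W`. -/
def rcomp {W : Type*} (R S : Set (W × W)) : Set (W × W) :=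
  {p | ∃ y, (p.1, y) ∈ R ∧ (y, p.2) ∈ S}

/-- Left residual `R \ S`. -/
def lres {W : Type*} (R S : Set (W × W)) : Set (W × W) :=
  {p | ∀ x, (x, p.1) ∈ R → (x, p.2) ∈ S}

/-- Right residual `S / R`. -/
def rres {W : Type*} (S R : Set (W × W)) : Set (W × W) :=
  {p | ∀ z, (p.2, z) ∈ R → (p.1, z) ∈ S}

/-- The diagonal relation `δ = {(x,x) | x ∈ W}`. -/
def diag {W : Type*} : Set (W × W) := {p | p.1 = p.2}

/-- If `𝔄` is closed under composition, residuals and intersection and `U ∈ 𝔄` is the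
`𝔄`-unit (`U∘R = R∘U = R` for all `R ∈ 𝔄`), then for every `R ∈ 𝔄` one has
`U ⊆ R ↔ δ ⊆ R`; in particular `δ ⊆ U`. -/
theorem unit_subset_iff_diag_subset (W : Type*) (𝔄 : Set (Set (W × W)))
    (hcomp : ∀ R ∈ 𝔄, ∀ S ∈ 𝔄, rcomp R S ∈ 𝔄)
    (hlres : ∀ R ∈ 𝔄, ∀ S ∈ 𝔄, lres R S ∈ 𝔄)
    (hrres : ∀ S ∈ 𝔄, ∀ R ∈ 𝔄, rres S R ∈ 𝔄)
    (hinter : ∀ R ∈ 𝔄, ∀ S ∈ 𝔄, R ∩ S ∈ 𝔄)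
    (U : Set (W × W)) (hU : U ∈ 𝔄)
    (hunit : ∀ R ∈ 𝔄, rcomp U R = R ∧ rcomp R U = R) :
    (∀ R ∈ 𝔄, U ⊆ R ↔ diag ⊆ R) ∧ diag ⊆ U := by
  have hdiag : diag ⊆ U := by
    rintro ⟨x, y⟩ (rfl : x = y)
    have hx : (x, x) ∈ lres U U := fun _ h => h
    rw [← (hunit _ (hlres U hU U hU)).1] at hx
    obtain ⟨y, hxy, hyx⟩ := hx
    exact hyx x hxy
  refine ⟨fun R hR => ⟨hdiag.trans, fun h => ?_⟩, hdiag⟩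
  rintro ⟨x, y⟩ hxy
  rw [← (hunit R hR).1]
  exact ⟨y, hxy, h rfl⟩
end

section
/- For any set W and any binary relations P, Q ⊆ W×W, (∅/(∅/P)) ∘ (∅/(∅/Q)) ⊆ (∅/(∅/Q)) ∘ (∅/(∅/P)). (This is the semantic half of the counterexample for constant 0: the sequent 0/(0/p), 0/(0/q) → (0/(0/q))·(0/(0/p)) is true in every square R-model with the standard interpretation v(0) = ∅.) -/
/-- For any binary relations `P, Q` on `W`,
`(∅/(∅/P)) ∘ (∅/(∅/Q)) ⊆ (∅/(∅/Q)) ∘ (∅/(∅/P))`. -/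
theorem double_zero_residuals_commute (W : Type*) (P Q : Set (W × W)) :
    rcomp (rres (∅ : Set (W × W)) (rres ∅ P)) (rres (∅ : Set (W × W)) (rres ∅ Q)) ⊆
      rcomp (rres (∅ : Set (W × W)) (rres ∅ Q)) (rres (∅ : Set (W × W)) (rres ∅ P)) := by
  rintro ⟨a, b⟩ ⟨y, hP, hQ⟩
  exact ⟨y, fun z hz => hQ z hz, fun z hz => hP z hz⟩
end

section
/- For distinct propositional variables p and q, the sequent 0/(0/p), 0/(0/q) → (0/(0/q))·(0/(0/p)) is not derivable in L^Λ(∧,0,1). -/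
/-- Formulae of the Lambek calculus with intersection and constants 0 and 1. -/
inductive Fm where
  | var : ℕ → Fm                -- propositional variable
  | zero : Fm                   -- constant 0
  | one : Fm                    -- constant 1
  | mul : Fm → Fm → Fm          -- product A·B
  | ldiv : Fm → Fm → Fm         -- left division A\B
  | rdiv : Fm → Fm → Fm         -- right division B/A
  | inter : Fm → Fm → Fm        -- intersection A∧B

/-- Derivability of sequents in `L^Λ(∧,0,1)` from a set `H` of extra (non-logical)
axioms.  A sequent is a pair of a list of formulae (antecedent) and a formula
(succedent). -/
inductive Deriv (H : Set (List Fm × Fm)) : List Fm → Fm → Prop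
  | hyp {P B} : (P, B) ∈ H → Deriv H P B
  | id (A) : Deriv H [A] A
  | oneR : Deriv H [] Fm.one
  | zeroL (Γ Δ C) : Deriv H (Γ ++ [Fm.zero] ++ Δ) C
  | cut {P A Γ Δ C} : Deriv H P A → Deriv H (Γ ++ [A] ++ Δ) C →
      Deriv H (Γ ++ P ++ Δ) C
  | ldivL {P A Γ B Δ C} : Deriv H P A → Deriv H (Γ ++ [B] ++ Δ) C →
      Deriv H (Γ ++ P ++ [Fm.ldiv A B] ++ Δ) C
  | ldivR {P A B} : Deriv H (A :: P) B → Deriv H P (Fm.ldiv A B)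
  | rdivL {P A Γ B Δ C} : Deriv H P A → Deriv H (Γ ++ [B] ++ Δ) C →
      Deriv H (Γ ++ [Fm.rdiv B A] ++ P ++ Δ) C
  | rdivR {P A B} : Deriv H (P ++ [A]) B → Deriv H P (Fm.rdiv B A)
  | mulL {Γ A B Δ C} : Deriv H (Γ ++ [A, B] ++ Δ) C →
      Deriv H (Γ ++ [Fm.mul A B] ++ Δ) C
  | mulR {P A Δ B} : Deriv H P A → Deriv H Δ B → Deriv H (P ++ Δ) (Fm.mul A B)
  | andL1 {Γ A B Δ C} : Deriv H (Γ ++ [A] ++ Δ) C →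
      Deriv H (Γ ++ [Fm.inter A B] ++ Δ) C
  | andL2 {Γ A B Δ C} : Deriv H (Γ ++ [B] ++ Δ) C →
      Deriv H (Γ ++ [Fm.inter A B] ++ Δ) C
  | andR {P A B} : Deriv H P A → Deriv H P B → Deriv H P (Fm.inter A B)
  | oneL {Γ Δ C} : Deriv H (Γ ++ Δ) C → Deriv H (Γ ++ [Fm.one] ++ Δ) C

/-- Interpretation of formulae as languages over `α`, where the zero words are those of `I`. -/
def Fm.lang {α : Type*} (I : Language α) (v : ℕ → Language α) : Fm → Language α
  | .var n => v n + I
  | .zero => I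
  | .one => 1 + I
  | .mul A B => A.lang I v * B.lang I v + I
  | .ldiv A B => {w | ∀ a ∈ A.lang I v, a ++ w ∈ B.lang I v}
  | .rdiv B A => {w | ∀ a ∈ A.lang I v, w ++ a ∈ B.lang I v}
  | .inter A B => A.lang I v ⊓ B.lang I v

section Soundness

variable {α : Type*} {I : Language α} {v : ℕ → Language α}

theorem Fm.le_lang (hl : ⊤ * I ≤ I) (hr : I * ⊤ ≤ I) (A : Fm) : I ≤ A.lang I v := by
  induction A with
  | var n => exact le_sup_right
  | zero => exact le_rfl
  | one => exact le_sup_right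
  | mul A B => exact le_sup_right
  | ldiv A B _ ihB =>
    intro w hw a _
    exact ihB (hl (Language.append_mem_mul (Set.mem_univ a) hw))
  | rdiv B A ihB _ =>
    intro w hw a _
    exact ihB (hr (Language.append_mem_mul hw (Set.mem_univ a)))
  | inter A B ihA ihB => exact le_inf ihA ihB

theorem Fm.lang_mul_ldiv_le (A B : Fm) :
    A.lang I v * (Fm.ldiv A B).lang I v ≤ B.lang I v := by
  intro w hw
  obtain ⟨a, ha, b, hb, rfl⟩ := Language.mem_mul.1 hw
  exact hb a ha

theorem Fm.lang_rdiv_mul_le (A B : Fm) :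
    (Fm.rdiv B A).lang I v * A.lang I v ≤ B.lang I v := by
  intro w hw
  obtain ⟨a, ha, b, hb, rfl⟩ := Language.mem_mul.1 hw
  exact ha b hb

theorem Language.mul_mul_le_of_le_ideal (hl : ⊤ * I ≤ I) (hr : I * ⊤ ≤ I) {J : Language α}
    (hJ : J ≤ I) (X Y : Language α) : X * (J * Y) ≤ I :=
  (mul_le_mul' le_top ((mul_le_mul' hJ le_top).trans hr)).trans hl

/-- Soundness of the interpretation when `I` is a two-sided ideal. -/
theorem Deriv.prod_lang_le (hl : ⊤ * I ≤ I) (hr : I * ⊤ ≤ I) {Γ : List Fm} {C : Fm}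
    (h : Deriv ∅ Γ C) : (Γ.map (Fm.lang I v)).prod ≤ C.lang I v := by
  have ideal (X Y : Language α) (C : Fm) : X * (I * Y) ≤ C.lang I v :=
    (Language.mul_mul_le_of_le_ideal hl hr le_rfl X Y).trans (C.le_lang hl hr)
  induction h with
  | hyp h => exact h.elim
  | id A => simp
  | oneR => exact le_sup_left
  | zeroL Γ Δ C => simpa [Fm.lang, mul_assoc] using ideal _ _ C
  | cut _ _ ih₁ ih₂ =>
    simp only [List.map_append, List.prod_append, List.map_cons, List.map_nil,
      List.prod_singleton] at *
    exact (mul_le_mul' (mul_le_mul' le_rfl ih₁) le_rfl).trans ih₂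
  | @ldivL P A Γ B Δ C _ _ ih₁ ih₂ =>
    simp only [List.map_append, List.prod_append, List.map_cons, List.map_nil,
      List.prod_singleton] at *
    refine le_trans ?_ ih₂
    rw [mul_assoc (List.map (Fm.lang I v) Γ).prod]
    exact mul_le_mul' (mul_le_mul' le_rfl
      ((mul_le_mul' ih₁ le_rfl).trans (Fm.lang_mul_ldiv_le A B))) le_rfl
  | ldivR _ ih =>
    intro w hw a ha
    exact ih (Language.append_mem_mul ha hw)
  | @rdivL P A Γ B Δ C _ _ ih₁ ih₂ =>
    simp only [List.map_append, List.prod_append, List.map_cons, List.map_nil,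
      List.prod_singleton] at *
    refine le_trans ?_ ih₂
    rw [mul_assoc (List.map (Fm.lang I v) Γ).prod]
    exact mul_le_mul' (mul_le_mul' le_rfl
      ((mul_le_mul' le_rfl ih₁).trans (Fm.lang_rdiv_mul_le A B))) le_rfl
  | rdivR _ ih =>
    intro w hw a ha
    simp only [List.map_append, List.prod_append, List.map_cons, List.map_nil,
      List.prod_singleton] at ih
    exact ih (Language.append_mem_mul hw ha)
  | mulL _ ih =>
    simp only [List.map_append, List.prod_append, List.map_cons, List.map_nil,
      List.prod_cons, List.prod_nil, mul_one, Fm.lang, mul_add,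
      add_mul] at *
    exact sup_le ih (by simpa [mul_assoc] using ideal _ _ _)
  | mulR _ _ ih₁ ih₂ =>
    rw [List.map_append, List.prod_append]
    exact (mul_le_mul' ih₁ ih₂).trans le_sup_left
  | andL1 _ ih =>
    simp only [List.map_append, List.prod_append, List.map_cons, List.map_nil,
      List.prod_singleton] at *
    exact (mul_le_mul' (mul_le_mul' le_rfl inf_le_left) le_rfl).trans ih
  | andL2 _ ih =>
    simp only [List.map_append, List.prod_append, List.map_cons, List.map_nil,
      List.prod_singleton] at *
    exact (mul_le_mul' (mul_le_mul' le_rfl inf_le_right) le_rfl).trans ih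
  | andR _ _ ih₁ ih₂ => exact le_inf ih₁ ih₂
  | oneL _ ih =>
    simp only [List.map_append, List.prod_append, List.map_cons, List.map_nil,
      List.prod_singleton, Fm.lang, mul_add, add_mul, mul_one] at *
    exact sup_le ih (by simpa [mul_assoc] using ideal _ _ _)

theorem Fm.mem_lang_rdiv_zero_var (hl : ⊤ * I ≤ I) {n : ℕ} {u w : List α} (hv : v n = {u}) :
    w ∈ (Fm.rdiv Fm.zero (Fm.var n)).lang I v ↔ w ++ u ∈ I := by
  constructor
  · intro h
    exact h u (Or.inl (hv ▸ rfl))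
  · rintro h a (ha | ha)
    · rw [hv] at ha
      obtain rfl : a = u := ha
      exact h
    · exact hl (Language.append_mem_mul (Set.mem_univ w) ha)

theorem Fm.mem_lang_rdiv_zero_rdiv_zero_var (hl : ⊤ * I ≤ I) {n : ℕ} {u w : List α}
    (hv : v n = {u}) :
    w ∈ (Fm.rdiv Fm.zero (Fm.rdiv Fm.zero (Fm.var n))).lang I v ↔
      ∀ a, a ++ u ∈ I → w ++ a ∈ I :=
  forall_congr' fun _ => imp_congr_left (Fm.mem_lang_rdiv_zero_var hl hv)

end Soundness

/-- Words that are not factors of `0123` of length at most two. -/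
def nonShortFactor : Language ℕ := {w | ¬ (w <:+: [0, 1, 2, 3] ∧ w.length ≤ 2)}

theorem mem_nonShortFactor {w : List ℕ} :
    w ∈ nonShortFactor ↔ ¬ (w <:+: [0, 1, 2, 3] ∧ w.length ≤ 2) := Iff.rfl

theorem mem_nonShortFactor_of_infix {u w : List ℕ} (h : u <:+: w) (hu : u ∈ nonShortFactor) :
    w ∈ nonShortFactor :=
  fun hw => hu ⟨h.trans hw.1, h.length_le.trans hw.2⟩

theorem top_mul_nonShortFactor_le : ⊤ * nonShortFactor ≤ nonShortFactor := by
  intro w hw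
  obtain ⟨a, -, b, hb, rfl⟩ := Language.mem_mul.1 hw
  exact mem_nonShortFactor_of_infix (List.suffix_append a b).isInfix hb

theorem nonShortFactor_mul_top_le : nonShortFactor * ⊤ ≤ nonShortFactor := by
  intro w hw
  obtain ⟨a, ha, b, -, rfl⟩ := Language.mem_mul.1 hw
  exact mem_nonShortFactor_of_infix (List.prefix_append a b).isInfix ha

/-- For distinct variables `p ≠ q`, the sequent
`0/(0/p), 0/(0/q) → (0/(0/q))·(0/(0/p))` is not derivable in `L^Λ(∧,0,1)`
(i.e. without extra hypotheses). -/
theorem zero_sequent_not_derivable (p q : ℕ) (hpq : p ≠ q) :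
    ¬ Deriv (∅ : Set (List Fm × Fm))
        [Fm.rdiv Fm.zero (Fm.rdiv Fm.zero (Fm.var p)),
         Fm.rdiv Fm.zero (Fm.rdiv Fm.zero (Fm.var q))]
        (Fm.mul (Fm.rdiv Fm.zero (Fm.rdiv Fm.zero (Fm.var q)))
                (Fm.rdiv Fm.zero (Fm.rdiv Fm.zero (Fm.var p)))) := by
  intro h
  let v : ℕ → Language ℕ := fun n => if n = p then {[2]} else {[3]}
  have hvp : v p = {[2]} := if_pos rfl
  have hvq : v q = {[3]} := if_neg hpq.symm
  have hl := top_mul_nonShortFactor_le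
  have memP {w : List ℕ} := Fm.mem_lang_rdiv_zero_rdiv_zero_var (w := w) hl hvp
  have memQ {w : List ℕ} := Fm.mem_lang_rdiv_zero_rdiv_zero_var (w := w) hl hvq
  have h01 : [0, 1] ∉ nonShortFactor := by rw [mem_nonShortFactor]; decide
  have hle := h.prod_lang_le (v := v) hl nonShortFactor_mul_top_le
  simp only [List.map_cons, List.map_nil, List.prod_cons, List.prod_nil, mul_one] at hle
  have hP : [0] ∈ (Fm.rdiv Fm.zero (Fm.rdiv Fm.zero (Fm.var p))).lang nonShortFactor v := by
    refine memP.2 fun a ha hw => ha ?_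
    match a, hw with
    | [], _ => decide
    | [b], hw =>
      obtain rfl : b = 1 := by simpa [List.infix_cons_iff] using hw.1
      decide
    | _ :: _ :: _, hw => simp at hw
  have hQ : [1] ∈ (Fm.rdiv Fm.zero (Fm.rdiv Fm.zero (Fm.var q))).lang nonShortFactor v := by
    refine memQ.2 fun a ha hw => ha ?_
    match a, hw with
    | [], _ => decide
    | [b], hw =>
      obtain rfl : b = 2 := by simpa [List.infix_cons_iff] using hw.1
      decide
    | _ :: _ :: _, hw => simp at hw
  rcases hle (Language.append_mem_mul hP hQ) with hm | hm
  · obtain ⟨a, ha, b, hb, hab⟩ := Language.mem_mul.1 hm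
    rw [memQ] at ha
    rw [memP] at hb
    match a, hab with
    | [], _ => exact h01 (ha [0, 1] (by rw [mem_nonShortFactor]; decide))
    | [c], hab =>
      obtain ⟨rfl, -⟩ : c = 0 ∧ b = [1] := by simpa using hab
      exact h01 (ha [1] (by rw [mem_nonShortFactor]; decide))
    | _ :: _ :: _, hab =>
      obtain ⟨-, -, -, rfl⟩ := by simpa using hab
      exact h01 (hb [0, 1] (by rw [mem_nonShortFactor]; decide))
  · exact h01 hm
end

section
/- For any non-empty set W and any binary relations A, B, C, D ⊆ W×W: if A\A ⊆ B∘C, then D ⊆ D ∘ B ∘ ((C∘B) ∩ (A\A)) ∘ C. (Hence the sequent d → d·b·((c·b)∧(a\a))·c semantically follows from a\a → b·c over square R-models.) -/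
/-- For any non-empty `W` and binary relations `A, B, C, D` on `W`: if `A\A ⊆ B∘C`, then
`D ⊆ D ∘ B ∘ ((C∘B) ∩ (A\A)) ∘ C`. -/
theorem counterexample_semantic_half (W : Type*) [Nonempty W]
    (A B C D : Set (W × W)) (h : lres A A ⊆ rcomp B C) :
    D ⊆ rcomp (rcomp (rcomp D B) (rcomp C B ∩ lres A A)) C := by
  rintro ⟨x, y⟩ hD
  have hrefl : ∀ w, (w, w) ∈ lres A A := fun _ _ ha => ha
  obtain ⟨z, hB, hC⟩ := h (hrefl y)
  exact ⟨z, ⟨z, ⟨y, hD, hB⟩, ⟨y, hC, hB⟩, hrefl z⟩, hC⟩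
end

section
/- Let W be a set and 𝔄 a family of binary relations on W closed under the residuals \ and / and intersection ∩ (but not necessarily under composition), and let 0_𝔄 ∈ 𝔄 satisfy 0_𝔄 ⊆ R for all R ∈ 𝔄. Then 0_𝔄 ∘ R ⊆ 0_𝔄 and R ∘ 0_𝔄 ⊆ 0_𝔄 for every R ∈ 𝔄, and more generally R₁ ∘ … ∘ Rₘ ∘ 0_𝔄 ∘ S₁ ∘ … ∘ S_k ⊆ 0_𝔄 for any R₁, …, Rₘ, S₁, …, S_k ∈ 𝔄 (m, k ≥ 0). -/
theorem rcomp_subset_iff_subset_rres {W : Type*} {R S T : Set (W × W)} :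
    rcomp R S ⊆ T ↔ R ⊆ rres T S :=
  ⟨fun h p hp _ hz => h ⟨p.2, hp, hz⟩, fun h _ ⟨_, hR, hS⟩ => h hR _ hS⟩

theorem rcomp_subset_iff_subset_lres {W : Type*} {R S T : Set (W × W)} :
    rcomp R S ⊆ T ↔ S ⊆ lres R T :=
  ⟨fun h p hp _ hx => h ⟨p.1, hx, hp⟩, fun h _ ⟨_, hR, hS⟩ => h hS _ hR⟩

theorem rcomp_subset_rcomp {W : Type*} {R R' S S' : Set (W × W)} (hR : R ⊆ R') (hS : S ⊆ S') :
    rcomp R S ⊆ rcomp R' S' :=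
  fun _ ⟨y, h₁, h₂⟩ => ⟨y, hR h₁, hS h₂⟩

theorem foldl_rcomp_subset {W : Type*} {Z T : Set (W × W)} (hT : T ⊆ Z)
    (Ss : List (Set (W × W))) (h : ∀ S ∈ Ss, rcomp Z S ⊆ Z) : Ss.foldl rcomp T ⊆ Z := by
  induction Ss generalizing T with
  | nil => exact hT
  | cons S Ss ih =>
    exact ih ((rcomp_subset_rcomp hT subset_rfl).trans (h S (by simp)))
      fun S' hS' => h S' (List.mem_cons_of_mem _ hS')

theorem foldr_rcomp_subset {W : Type*} {Z T : Set (W × W)} (hT : T ⊆ Z)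
    (Rs : List (Set (W × W))) (h : ∀ R ∈ Rs, rcomp R Z ⊆ Z) : Rs.foldr rcomp T ⊆ Z := by
  induction Rs with
  | nil => exact hT
  | cons R Rs ih =>
    exact (rcomp_subset_rcomp subset_rfl (ih fun R' hR' => h R' (List.mem_cons_of_mem _ hR'))).trans
      (h R (by simp))

/-- Let `𝔄` be a family of binary relations on `W` closed under the residuals and
intersection (not necessarily under composition), and `Z ∈ 𝔄` with `Z ⊆ R` for all
`R ∈ 𝔄`. Then `Z∘R ⊆ Z` and `R∘Z ⊆ Z` for every `R ∈ 𝔄`, and more generally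
`R₁∘…∘Rₘ∘Z∘S₁∘…∘S_k ⊆ Z` for any `R₁,…,Rₘ,S₁,…,S_k ∈ 𝔄`. -/
theorem zero_absorbs_compositions (W : Type*) (𝔄 : Set (Set (W × W)))
    (hlres : ∀ R ∈ 𝔄, ∀ S ∈ 𝔄, lres R S ∈ 𝔄)
    (hrres : ∀ S ∈ 𝔄, ∀ R ∈ 𝔄, rres S R ∈ 𝔄)
    (hinter : ∀ R ∈ 𝔄, ∀ S ∈ 𝔄, R ∩ S ∈ 𝔄)
    (Z : Set (W × W)) (hZ : Z ∈ 𝔄) (hzero : ∀ R ∈ 𝔄, Z ⊆ R) :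
    (∀ R ∈ 𝔄, rcomp Z R ⊆ Z) ∧ (∀ R ∈ 𝔄, rcomp R Z ⊆ Z) ∧
    (∀ Rs Ss : List (Set (W × W)), (∀ R ∈ Rs, R ∈ 𝔄) → (∀ S ∈ Ss, S ∈ 𝔄) →
      Rs.foldr rcomp (Ss.foldl rcomp Z) ⊆ Z) := by
  have hright : ∀ R ∈ 𝔄, rcomp Z R ⊆ Z := fun R hR =>
    rcomp_subset_iff_subset_rres.2 (hzero _ (hrres Z hZ R hR))
  have hleft : ∀ R ∈ 𝔄, rcomp R Z ⊆ Z := fun R hR =>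
    rcomp_subset_iff_subset_lres.2 (hzero _ (hlres R hR Z hZ))
  exact ⟨hright, hleft, fun Rs Ss hRs hSs =>
    foldr_rcomp_subset (foldl_rcomp_subset subset_rfl Ss fun S hS => hright S (hSs S hS)) Rs
      fun R hR => hleft R (hRs R hR)⟩
end
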